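/- arXiv:2403.07686 — 4 statements merged into one kernel-verified Lean document; each statement's English description precedes it below -/
import Mathlib

section
/- Let X be a stratified space over a poset P. If X has the horn filling property for all inner pairs (J,k), then X has the horn filling property for all admissible pairs (J,k). In other words, every categorically fibrant stratified space is diagrammatically fibrant. -/
open Set unitInterval

noncomputable section

/-! ### Stratified spaces over a poset -/

/-- Continuity into the Alexandrov topology on a preordered set: preimages of
upper sets are open. -/
def AlexContinuous {P : Type*} [Preorder P] {X : Type*} [TopologicalSpace X] (s : X → P) : Prop :=
  ∀ U : Set P, IsUpperSet U → IsOpen (s ⁻¹' U)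

lemma stdSimplex.exists_pos' {n : ℕ} (x : stdSimplex ℝ (Fin (n + 1))) :
    ∃ i, 0 < (x : Fin (n + 1) → ℝ) i := by
  by_contra h
  push_neg at h
  have h1 : ∑ i, (x : Fin (n + 1) → ℝ) i = 1 := x.2.2
  have h2 : ∑ i, (x : Fin (n + 1) → ℝ) i ≤ 0 := Finset.sum_nonpos fun i _ => h i
  linarith

/-- The largest index with positive barycentric coordinate. -/
def maxSupp {n : ℕ} (x : stdSimplex ℝ (Fin (n + 1))) : Fin (n + 1) :=
  (Finset.univ.filter fun i => 0 < (x : Fin (n + 1) → ℝ) i).max' (by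
    obtain ⟨i, hi⟩ := stdSimplex.exists_pos' x
    exact ⟨i, Finset.mem_filter.2 ⟨Finset.mem_univ i, hi⟩⟩)

/-- The stratification of the realized stratified simplex `|Δ^J|` of a flag `J`. -/
def flagStrat {P : Type*} {n : ℕ} (J : Fin (n + 1) → P) (x : stdSimplex ℝ (Fin (n + 1))) : P :=
  J (maxSupp x)

/-- The `k`-th horn of the standard `n`-simplex, as a subset of the simplex. -/
def hornSet (n : ℕ) (k : Fin (n + 1)) : Set (stdSimplex ℝ (Fin (n + 1))) :=
  {x | ∃ i, i ≠ k ∧ (x : Fin (n + 1) → ℝ) i = 0}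

/-- `X` (stratified by `s`) has the horn filling property with respect to the
realized stratified horn inclusion `|Λ^J_k| ↪ |Δ^J|`. -/
def HornFilling {P : Type*} {X : Type*} [TopologicalSpace X] (s : X → P) {n : ℕ}
    (J : Fin (n + 1) → P) (k : Fin (n + 1)) : Prop :=
  ∀ f : hornSet n k → X, Continuous f →
    (∀ y : hornSet n k, s (f y) = flagStrat J y.1) →
    ∃ g : stdSimplex ℝ (Fin (n + 1)) → X, Continuous g ∧
      (∀ x, s (g x) = flagStrat J x) ∧ ∀ y : hornSet n k, g y.1 = f y

/-- `(J, k)` is an inner horn datum. -/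
def IsInner (n : ℕ) (k : Fin (n + 1)) : Prop := 0 < (k : ℕ) ∧ (k : ℕ) < n

/-- `(J, k)` is an admissible horn datum. -/
def IsAdmissible {P : Type*} {n : ℕ} (J : Fin (n + 1) → P) (k : Fin (n + 1)) : Prop :=
  IsInner n k ∨
    ((k : ℕ) = 0 ∧ ∃ h : 0 < n, J ⟨0, Nat.succ_pos n⟩ = J ⟨1, Nat.succ_lt_succ h⟩) ∨
    ((k : ℕ) = n ∧ ∃ _h : 0 < n, J ⟨n - 1, by omega⟩ = J ⟨n, Nat.lt_succ_self n⟩)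

/-- A stratified space is categorically fibrant if it has the horn filling property
with respect to all inner stratified horn inclusions. -/
def CatFibrant {P : Type*} [Preorder P] {X : Type*} [TopologicalSpace X] (s : X → P) : Prop :=
  ∀ (n : ℕ) (J : Fin (n + 1) → P), Monotone J → ∀ k : Fin (n + 1), IsInner n k → HornFilling s J k

/-- A stratified space is diagrammatically fibrant if it has the horn filling property
with respect to all admissible stratified horn inclusions. -/
def DiagFibrant {P : Type*} [Preorder P] {X : Type*} [TopologicalSpace X] (s : X → P) : Prop :=
  ∀ (n : ℕ) (J : Fin (n + 1) → P), Monotone J → ∀ k : Fin (n + 1), IsAdmissible J k →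
    HornFilling s J k

/-! ### Exit paths and refinedness -/

/-- An exit path: `s ∘ γ` is constant on `(0, 1]` and does not decrease from `γ 0`. -/
def IsExitPath {P : Type*} [Preorder P] {X : Type*} [TopologicalSpace X]
    (s : X → P) (γ : C(I, X)) : Prop :=
  (∀ t t' : I, t ≠ 0 → t' ≠ 0 → s (γ t) = s (γ t')) ∧ ∀ t : I, s (γ 0) ≤ s (γ t)

/-- One step in a chain of exit paths. -/
def ExitStep {P : Type*} [Preorder P] {X : Type*} [TopologicalSpace X] (s : X → P)
    (x y : X) : Prop :=
  ∃ γ : C(I, X), IsExitPath s γ ∧ γ 0 = x ∧ γ 1 = y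

/-- A stratified space is refined if its stratification is surjective and the order
relation is exactly detected by finite chains of exit paths. -/
def IsRefined {P : Type*} [Preorder P] {X : Type*} [TopologicalSpace X] (s : X → P) : Prop :=
  Function.Surjective s ∧ ∀ x y : X, s x ≤ s y ↔ Relation.ReflTransGen (ExitStep s) x y

/-- The frontier relation: the `p`-stratum meets the closure of the `q`-stratum. -/
def FrontierRel {P : Type*} {X : Type*} [TopologicalSpace X] (s : X → P) (p q : P) : Prop :=
  (s ⁻¹' {p} ∩ closure (s ⁻¹' {q})).Nonempty

/-- Weakly frontier stratified. -/
def WeaklyFrontierStratified {P : Type*} [Preorder P] {X : Type*} [TopologicalSpace X]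
    (s : X → P) : Prop :=
  Function.Surjective s ∧ ∀ p q : P, p ≤ q ↔ Relation.ReflTransGen (FrontierRel s) p q

/-- Frontier stratified. -/
def FrontierStratified {P : Type*} [Preorder P] {X : Type*} [TopologicalSpace X]
    (s : X → P) : Prop :=
  WeaklyFrontierStratified s ∧ ∀ p q : P, FrontierRel s p q → s ⁻¹' {p} ⊆ closure (s ⁻¹' {q})

/-! ### Homotopy links -/

lemma I_one_ne_zero : (1 : I) ≠ 0 := fun h => one_ne_zero (α := ℝ) (congrArg Subtype.val h)

/-- The pairwise homotopy link of the pair of strata `p`, `q`. -/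
abbrev PairHolink {P : Type*} {X : Type*} [TopologicalSpace X] (s : X → P) (p q : P) :=
  {γ : C(I, X) // s (γ 0) = p ∧ ∀ t : I, t ≠ 0 → s (γ t) = q}

/-- Starting point evaluation on the pairwise homotopy link. -/
def pairHolinkEv0 {P : Type*} {X : Type*} [TopologicalSpace X] (s : X → P) (p q : P)
    (γ : PairHolink s p q) : {x : X // s x = p} :=
  ⟨γ.1 0, γ.2.1⟩

/-- A Serre fibration: a map with the homotopy lifting property with respect to all
Euclidean disks. -/
def IsSerreFibration {E B : Type*} [TopologicalSpace E] [TopologicalSpace B] (π : E → B) : Prop :=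
  ∀ (n : ℕ)
    (H : ↥(Metric.closedBall (0 : EuclideanSpace ℝ (Fin n)) 1) × I → B)
    (h₀ : ↥(Metric.closedBall (0 : EuclideanSpace ℝ (Fin n)) 1) → E),
    Continuous H → Continuous h₀ → (∀ d, π (h₀ d) = H (d, 0)) →
    ∃ G : ↥(Metric.closedBall (0 : EuclideanSpace ℝ (Fin n)) 1) × I → E,
      Continuous G ∧ (∀ d, G (d, 0) = h₀ d) ∧ ∀ z, π (G z) = H z

/-- The stratified homotopy link of the stratum `p`: exit paths starting in the
`p`-stratum and immediately leaving it. -/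
abbrev StratHolink {P : Type*} [Preorder P] {X : Type*} [TopologicalSpace X]
    (s : X → P) (p : P) :=
  {γ : C(I, X) // s (γ 0) = p ∧ (∀ t : I, t ≠ 0 → p < s (γ t)) ∧
    ∀ t t' : I, t ≠ 0 → t' ≠ 0 → s (γ t) = s (γ t')}

/-- The stratification of the stratified homotopy link over `P_{>p}`. -/
def stratHolinkStrat {P : Type*} [Preorder P] {X : Type*} [TopologicalSpace X]
    (s : X → P) (p : P) (γ : StratHolink s p) : {q : P // p < q} :=
  ⟨s (γ.1 1), γ.2.2.1 1 I_one_ne_zero⟩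

/-- Endpoint evaluation on the stratified homotopy link. -/
def stratHolinkEv1 {P : Type*} [Preorder P] {X : Type*} [TopologicalSpace X]
    (s : X → P) (p : P) (γ : StratHolink s p) : {x : X // p < s x} :=
  ⟨γ.1 1, γ.2.2.1 1 I_one_ne_zero⟩

/-- The generalized homotopy link of a (regular) flag `Iflag`: the space of stratified
maps `|Δ^Iflag| → X`, topologized via the compact-open topology. -/
abbrev Holink {P : Type*} {X : Type*} [TopologicalSpace X] (s : X → P) {m : ℕ}
    (Iflag : Fin (m + 1) → P) :=
  {f : C(stdSimplex ℝ (Fin (m + 1)), X) // ∀ x, s (f x) = flagStrat Iflag x}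

/-! ### Weak homotopy equivalences -/

/-- The boundary of the `n`-cube. -/
def cubeBoundary (n : ℕ) : Set (Fin n → I) := {y | ∃ i, y i = 0 ∨ y i = 1}

/-- Generalized loops: maps of the `n`-cube collapsing the boundary to the basepoint. -/
abbrev GenLoops (n : ℕ) (X : Type*) [TopologicalSpace X] (x : X) :=
  {p : C((Fin n → I), X) // ∀ y ∈ cubeBoundary n, p y = x}

/-- Homotopy rel boundary as a setoid on generalized loops. -/
def genLoopSetoid (n : ℕ) (X : Type*) [TopologicalSpace X] (x : X) :
    Setoid (GenLoops n X x) where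
  r p q := p.1.HomotopicRel q.1 (cubeBoundary n)
  iseqv := ⟨fun p => ContinuousMap.HomotopicRel.refl p.1,
    fun h => h.symm, fun h h' => h.trans h'⟩

/-- The `n`-th homotopy group (as a type) of `X` at `x`. -/
def HtpyGroup (n : ℕ) (X : Type*) [TopologicalSpace X] (x : X) :=
  Quotient (genLoopSetoid n X x)

/-- The map induced by a continuous map on homotopy groups. -/
def htpyGroupMap (n : ℕ) {X Y : Type*} [TopologicalSpace X] [TopologicalSpace Y]
    (f : C(X, Y)) (x : X) : HtpyGroup n X x → HtpyGroup n Y (f x) :=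
  Quotient.map (fun p => ⟨f.comp p.1, fun y hy => by
      simp [ContinuousMap.comp_apply, p.2 y hy]⟩)
    (fun p q h => h.map fun F => F.compContinuousMap f)

/-- The map induced by a continuous map on path components. -/
def pi0Map {X Y : Type*} [TopologicalSpace X] [TopologicalSpace Y] (f : C(X, Y)) :
    ZerothHomotopy X → ZerothHomotopy Y :=
  Quotient.map f fun _ _ h => ⟨h.somePath.map f.continuous⟩

/-- A weak homotopy equivalence: a continuous map inducing a bijection on path
components and isomorphisms on all homotopy groups at all basepoints. -/
def IsWeakHomotopyEquiv {X Y : Type*} [TopologicalSpace X] [TopologicalSpace Y]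
    (f : C(X, Y)) : Prop :=
  Function.Bijective (pi0Map f) ∧
    ∀ (n : ℕ) (x : X), Function.Bijective (htpyGroupMap (n + 1) f x)

/-! ### Induced maps and diagrammatic equivalences -/

/-- The map induced on generalized homotopy links by a stratified map. -/
def holinkCMap {P : Type*} {X Y : Type*} [TopologicalSpace X] [TopologicalSpace Y]
    (sX : X → P) (sY : Y → P) (w : C(X, Y)) (hw : ∀ x, sY (w x) = sX x)
    {m : ℕ} (Iflag : Fin (m + 1) → P) :
    C(Holink sX Iflag, Holink sY Iflag) :=
  ⟨fun f => ⟨w.comp f.1, fun x => by simp [ContinuousMap.comp_apply, hw, f.2 x]⟩,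
    Continuous.subtype_mk
      ((ContinuousMap.continuous_postcomp w).comp continuous_subtype_val) _⟩

/-- A stratified map is a diagrammatic equivalence if it induces weak homotopy
equivalences on all generalized homotopy links. -/
def IsDiagEquiv {P : Type*} [Preorder P] {X Y : Type*} [TopologicalSpace X] [TopologicalSpace Y]
    (sX : X → P) (sY : Y → P) (w : C(X, Y)) (hw : ∀ x, sY (w x) = sX x) : Prop :=
  ∀ (m : ℕ) (Iflag : Fin (m + 1) → P), StrictMono Iflag →
    IsWeakHomotopyEquiv (holinkCMap sX sY w hw Iflag)

/-- The restriction of a stratified map to the `q`-stratum. -/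
def stratumCMap {Q : Type*} {X Y : Type*} [TopologicalSpace X] [TopologicalSpace Y]
    (sX : X → Q) (sY : Y → Q) (w : C(X, Y)) (hw : ∀ x, sY (w x) = sX x) (q : Q) :
    C({x : X // sX x = q}, {y : Y // sY y = q}) :=
  ⟨fun x => ⟨w x.1, by rw [hw x.1]; exact x.2⟩,
    Continuous.subtype_mk (w.continuous.comp continuous_subtype_val)
      fun x => by show sY (w x.1) = q; rw [hw x.1]; exact x.2⟩

/-- The map induced on stratified homotopy links by a stratified map. -/
def stratHolinkCMap {P : Type*} [Preorder P] {X Y : Type*} [TopologicalSpace X]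
    [TopologicalSpace Y] {sX : X → P} {sY : Y → P} (w : C(X, Y))
    (hw : ∀ x, sY (w x) = sX x) (p : P) :
    C(StratHolink sX p, StratHolink sY p) :=
  ⟨fun γ => ⟨w.comp γ.1,
      by simpa [ContinuousMap.comp_apply, hw] using γ.2.1,
      fun t ht => by simpa [ContinuousMap.comp_apply, hw] using γ.2.2.1 t ht,
      fun t t' ht ht' => by simpa [ContinuousMap.comp_apply, hw] using γ.2.2.2 t t' ht ht'⟩,
    Continuous.subtype_mk
      ((ContinuousMap.continuous_postcomp w).comp continuous_subtype_val) _⟩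

lemma stratHolinkCMap_strat {P : Type*} [Preorder P] {X Y : Type*} [TopologicalSpace X]
    [TopologicalSpace Y] {sX : X → P} {sY : Y → P} (w : C(X, Y))
    (hw : ∀ x, sY (w x) = sX x) (p : P) (γ : StratHolink sX p) :
    stratHolinkStrat sY p (stratHolinkCMap w hw p γ) = stratHolinkStrat sX p γ :=
  Subtype.ext (hw _)

/-- The local homotopy link of `X` at `x ∈ X_p`: the fiber of the stratified homotopy
link over `x`. -/
abbrev LocalHolink {P : Type*} [Preorder P] {X : Type*} [TopologicalSpace X]
    (s : X → P) (p : P) (x : X) :=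
  {γ : StratHolink s p // (γ.1 : C(I, X)) 0 = x}

/-- The stratification of the local homotopy link over `P_{>p}`. -/
def localHolinkStrat {P : Type*} [Preorder P] {X : Type*} [TopologicalSpace X]
    (s : X → P) (p : P) (x : X) (γ : LocalHolink s p x) : {q : P // p < q} :=
  stratHolinkStrat s p γ.1

/-- The map induced on local homotopy links by a stratified map. -/
def localHolinkCMap {P : Type*} [Preorder P] {X Y : Type*} [TopologicalSpace X]
    [TopologicalSpace Y] {sX : X → P} {sY : Y → P} (w : C(X, Y))
    (hw : ∀ x, sY (w x) = sX x) (p : P) (x : X) :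
    C(LocalHolink sX p x, LocalHolink sY p (w x)) :=
  ⟨fun γ => ⟨stratHolinkCMap w hw p γ.1, by
      show (w.comp γ.1.1) 0 = w x
      simp [ContinuousMap.comp_apply, γ.2]⟩,
    Continuous.subtype_mk
      ((stratHolinkCMap w hw p).continuous.comp continuous_subtype_val)
      fun γ => by
        show (w.comp γ.1.1) 0 = w x
        simp [ContinuousMap.comp_apply, γ.2]⟩

lemma localHolinkCMap_strat {P : Type*} [Preorder P] {X Y : Type*} [TopologicalSpace X]
    [TopologicalSpace Y] {sX : X → P} {sY : Y → P} (w : C(X, Y))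
    (hw : ∀ x, sY (w x) = sX x) (p : P) (x : X) (γ : LocalHolink sX p x) :
    localHolinkStrat sY p (w x) (localHolinkCMap w hw p x γ) = localHolinkStrat sX p x γ :=
  Subtype.ext (hw _)

end

/-- The stratum of a point of `|Δ^J|` is the largest value of `J` on its support. -/
lemma isGreatest_flagStrat {P : Type*} [Preorder P] {n : ℕ} {J : Fin (n + 1) → P}
    (hJ : Monotone J) (x : stdSimplex ℝ (Fin (n + 1))) :
    IsGreatest (J '' {i | 0 < (x : Fin (n + 1) → ℝ) i}) (flagStrat J x) := by
  constructor
  · exact ⟨maxSupp x, (Finset.mem_filter.1 (Finset.max'_mem _ _)).2, rfl⟩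
  · rintro _ ⟨i, hi, rfl⟩
    exact hJ (Finset.le_max' _ _ (Finset.mem_filter.2 ⟨Finset.mem_univ i, hi⟩))

/-- The self-map of the standard simplex permuting the barycentric coordinates. -/
def simplexPerm {n : ℕ} (e : Equiv.Perm (Fin (n + 1))) (x : stdSimplex ℝ (Fin (n + 1))) :
    stdSimplex ℝ (Fin (n + 1)) :=
  ⟨fun i => (x : Fin (n + 1) → ℝ) (e i), fun i => x.2.1 (e i),
    (Equiv.sum_comp e (x : Fin (n + 1) → ℝ)).trans x.2.2⟩

lemma continuous_simplexPerm {n : ℕ} (e : Equiv.Perm (Fin (n + 1))) :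
    Continuous (simplexPerm e) :=
  continuous_induced_rng.2
    (continuous_pi fun i => (continuous_apply (e i)).comp continuous_subtype_val)

lemma simplexPerm_symm_simplexPerm {n : ℕ} (e : Equiv.Perm (Fin (n + 1)))
    (x : stdSimplex ℝ (Fin (n + 1))) : simplexPerm e.symm (simplexPerm e x) = x :=
  Subtype.ext (funext fun i => congrArg (x : Fin (n + 1) → ℝ) (e.apply_symm_apply i))

lemma simplexPerm_simplexPerm_symm {n : ℕ} (e : Equiv.Perm (Fin (n + 1)))
    (x : stdSimplex ℝ (Fin (n + 1))) : simplexPerm e (simplexPerm e.symm x) = x :=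
  simplexPerm_symm_simplexPerm e.symm x

lemma simplexPerm_mem_hornSet {n : ℕ} (e : Equiv.Perm (Fin (n + 1))) {k : Fin (n + 1)}
    {x : stdSimplex ℝ (Fin (n + 1))} (hx : x ∈ hornSet n (e k)) :
    simplexPerm e x ∈ hornSet n k := by
  obtain ⟨i, hik, hi⟩ := hx
  refine ⟨e.symm i, fun h => hik (by rw [← h, e.apply_symm_apply]), ?_⟩
  exact (congrArg (x : Fin (n + 1) → ℝ) (e.apply_symm_apply i)).trans hi

/-- Permuting vertices of equal stratum preserves the stratification of `|Δ^J|`. -/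
lemma flagStrat_simplexPerm {P : Type*} [PartialOrder P] {n : ℕ} {J : Fin (n + 1) → P}
    (hJ : Monotone J) {e : Equiv.Perm (Fin (n + 1))} (he : ∀ i, J (e i) = J i)
    (x : stdSimplex ℝ (Fin (n + 1))) : flagStrat J (simplexPerm e x) = flagStrat J x := by
  refine (isGreatest_flagStrat hJ _).unique ?_
  convert isGreatest_flagStrat hJ x using 1
  ext p
  constructor
  · rintro ⟨i, hi, rfl⟩
    exact ⟨e i, hi, he i⟩
  · rintro ⟨i, hi, rfl⟩
    refine ⟨e.symm i, ?_, by rw [← he, e.apply_symm_apply]⟩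
    change 0 < (x : Fin (n + 1) → ℝ) (e (e.symm i))
    rwa [e.apply_symm_apply]

/-- Horn filling is invariant under permuting vertices of equal stratum. -/
lemma HornFilling.of_perm {P : Type*} [PartialOrder P] {X : Type*} [TopologicalSpace X]
    {s : X → P} {n : ℕ} {J : Fin (n + 1) → P} (hJ : Monotone J) {k : Fin (n + 1)}
    (e : Equiv.Perm (Fin (n + 1))) (he : ∀ i, J (e i) = J i) (h : HornFilling s J (e k)) :
    HornFilling s J k := by
  intro f hf hfs
  obtain ⟨g, hg, hgs, hgf⟩ := h
    (fun y => f ⟨simplexPerm e y.1, simplexPerm_mem_hornSet e y.2⟩)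
    (hf.comp (Continuous.subtype_mk
      ((continuous_simplexPerm e).comp continuous_subtype_val) _))
    fun y => (hfs _).trans (flagStrat_simplexPerm hJ he y.1)
  have he' : ∀ i, J (e.symm i) = J i := fun i => by rw [← he, e.apply_symm_apply]
  refine ⟨fun x => g (simplexPerm e.symm x), hg.comp (continuous_simplexPerm e.symm),
    fun x => (hgs _).trans (flagStrat_simplexPerm hJ he' x), fun y => ?_⟩
  have hy : simplexPerm e.symm y.1 ∈ hornSet n (e k) :=
    simplexPerm_mem_hornSet e.symm (by simp)
  refine (hgf ⟨_, hy⟩).trans (congrArg f (Subtype.ext ?_))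
  exact simplexPerm_simplexPerm_symm e y.1

/-- Horns of an interval lying in a single stratum have constant fillers. -/
lemma HornFilling.of_dim_one {P : Type*} {X : Type*} [TopologicalSpace X] (s : X → P)
    {J : Fin (1 + 1) → P} (hJ : J 0 = J 1) (k : Fin (1 + 1)) : HornFilling s J k := by
  intro f _ hfs
  have hconst : ∀ x y, flagStrat J x = flagStrat J y := by
    have h : ∀ i, J i = J 1 := by
      intro i
      fin_cases i
      exacts [hJ, rfl]
    exact fun x y => (h _).trans (h _).symm
  have huniq : ∀ y z : hornSet 1 k, y = z := by
    rintro ⟨y, i, hik, hi⟩ ⟨z, j, hjk, hj⟩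
    obtain rfl : i = j := by omega
    have hy : y.1 0 + y.1 1 = 1 := (Fin.sum_univ_two _).symm.trans y.2.2
    have hz : z.1 0 + z.1 1 = 1 := (Fin.sum_univ_two _).symm.trans z.2.2
    change y.1 i = 0 at hi
    change z.1 i = 0 at hj
    refine Subtype.ext (Subtype.ext (funext fun l => ?_))
    change y.1 l = z.1 l
    have h01 : ∀ m : Fin (1 + 1), m = 0 ∨ m = 1 := by decide
    obtain rfl | rfl := h01 i
    all_goals obtain rfl | rfl := h01 l
    all_goals linarith
  have hv : ∃ y, y ∈ hornSet 1 k := by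
    refine ⟨⟨Pi.single k 1, single_mem_stdSimplex ℝ k⟩, k + 1, ?_, ?_⟩
    · fin_cases k <;> decide
    · exact Pi.single_eq_of_ne (by fin_cases k <;> decide) _
  obtain ⟨v, hv⟩ := hv
  exact ⟨fun _ => f ⟨v, hv⟩, continuous_const, fun x => (hfs _).trans (hconst _ _),
    fun y => congrArg f (huniq _ _)⟩

/-- If two vertices of a flag lie in the same stratum, horn filling at one of them gives horn
filling at the other. -/
lemma HornFilling.of_eq {P : Type*} [PartialOrder P] {X : Type*} [TopologicalSpace X]
    {s : X → P} {n : ℕ} {J : Fin (n + 1) → P} (hJ : Monotone J) {k l : Fin (n + 1)}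
    (hkl : J k = J l) (h : HornFilling s J l) : HornFilling s J k := by
  refine HornFilling.of_perm hJ (Equiv.swap k l) (fun i => ?_) (by rwa [Equiv.swap_apply_left])
  rw [Equiv.swap_apply_def]
  split_ifs with h₁ h₂
  · rw [h₁, hkl]
  · rw [h₂, hkl]
  · rfl

/-- Every categorically fibrant stratified space is diagrammatically fibrant: horn
filling for all inner pairs implies horn filling for all admissible pairs. -/
theorem catFibrant_diagFibrant {P : Type} [PartialOrder P] {X : Type} [TopologicalSpace X]
    (s : X → P) (hs : AlexContinuous s) (hcat : CatFibrant s) : DiagFibrant s := by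
  intro n J hJ k hk
  rcases hk with hk | ⟨hk, hn, h⟩ | ⟨hk, hn, h⟩
  · exact hcat n J hJ k hk
  · obtain rfl | hn := (Nat.succ_le_of_lt hn).eq_or_lt
    · exact HornFilling.of_dim_one s h k
    · obtain rfl : k = ⟨0, Nat.succ_pos n⟩ := Fin.ext hk
      exact HornFilling.of_eq hJ h (hcat n J hJ _ ⟨Nat.one_pos, hn⟩)
  · obtain rfl | hn := (Nat.succ_le_of_lt hn).eq_or_lt
    · exact HornFilling.of_dim_one s h k
    · obtain rfl : k = ⟨n, Nat.lt_succ_self n⟩ := Fin.ext hk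
      refine HornFilling.of_eq hJ h.symm (hcat n J hJ _ ⟨?_, ?_⟩) <;> dsimp only <;> omega
end

section
/- If a stratified space X over a poset P is refined, then every stratum of X is path-connected and X is weakly frontier stratified. -/
open Set unitInterval

section

variable {P : Type*} {X : Type*} [TopologicalSpace X] {s : X → P} {x y : X}

lemma ExitStep.le [Preorder P] (h : ExitStep s x y) : s x ≤ s y := by
  obtain ⟨γ, hγ, rfl, rfl⟩ := h
  exact hγ.2 1

lemma le_of_reflTransGen_exitStep [Preorder P] (h : Relation.ReflTransGen (ExitStep s) x y) :
    s x ≤ s y := by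
  induction h with
  | refl => exact le_rfl
  | tail _ h ih => exact ih.trans h.le

/-- An exit path between points of the same stratum is a path in that stratum. -/
lemma ExitStep.joinedIn [Preorder P] {p : P} (h : ExitStep s x y) (hx : s x = p) (hy : s y = p) :
    JoinedIn (s ⁻¹' {p}) x y := by
  obtain ⟨γ, hγ, h0, h1⟩ := h
  refine ⟨⟨γ, h0, h1⟩, fun t => ?_⟩
  show s (γ t) = p
  by_cases ht : t = 0
  · rw [ht, h0, hx]
  · rw [hγ.1 t 1 ht I_one_ne_zero, h1, hy]

lemma joinedIn_of_reflTransGen_exitStep [PartialOrder P] {p : P}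
    (h : Relation.ReflTransGen (ExitStep s) x y) (hx : s x = p) (hy : s y = p) :
    JoinedIn (s ⁻¹' {p}) x y := by
  induction h with
  | refl => exact JoinedIn.refl hx
  | @tail z w hz hzw ih =>
    have hzp : s z = p :=
      le_antisymm (hzw.le.trans_eq hy) (hx.symm.trans_le (le_of_reflTransGen_exitStep hz))
    exact (ih hzp).trans (hzw.joinedIn hzp hy)

lemma ExitStep.frontierRel [Preorder P] (h : ExitStep s x y) : FrontierRel s (s x) (s y) := by
  obtain ⟨γ, hγ, rfl, rfl⟩ := h
  have h0 : (0 : I) ∈ closure {0}ᶜ := dense_compl_singleton (0 : I) 0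
  exact ⟨γ 0, rfl,
    map_mem_closure γ.continuous h0 fun t ht => hγ.1 t 1 ht I_one_ne_zero⟩

lemma FrontierRel.le [Preorder P] (hs : AlexContinuous s) {p q : P} (h : FrontierRel s p q) :
    p ≤ q := by
  obtain ⟨x, hx, hxq⟩ := h
  obtain ⟨y, hpy, hyq⟩ :=
    mem_closure_iff.1 hxq _ (hs (Ici p) (isUpperSet_Ici p)) (mem_singleton_iff.1 hx).ge
  exact le_of_le_of_eq hpy hyq

end

/-- If a stratified space is refined, then its strata are path-connected and it is
weakly frontier stratified. -/
theorem refined_implies_weakly_frontier {P : Type} [PartialOrder P] {X : Type}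
    [TopologicalSpace X] (s : X → P) (hs : AlexContinuous s) (href : IsRefined s) :
    (∀ p : P, IsPathConnected (s ⁻¹' {p})) ∧ WeaklyFrontierStratified s := by
  obtain ⟨hsurj, hle⟩ := href
  refine ⟨fun p => ?_, hsurj, fun p q => ⟨fun hpq => ?_, fun h => ?_⟩⟩
  · obtain ⟨x, hx⟩ := hsurj p
    exact ⟨x, hx, fun {y} hy =>
      joinedIn_of_reflTransGen_exitStep ((hle x y).1 (hx.trans hy.symm).le) hx hy⟩
  · obtain ⟨x, rfl⟩ := hsurj p
    obtain ⟨y, rfl⟩ := hsurj q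
    exact ((hle x y).1 hpq).lift s fun _ _ h => h.frontierRel
  · induction h with
    | refl => exact le_rfl
    | tail _ h ih => exact ih.trans (h.le hs)
end

section
/- Let N be a stratified space over a poset P whose stratification s takes values in P_{≥p} = {r ∈ P : r ≥ p} for some p ∈ P. Suppose R : N × [0,1] → N is a continuous map such that (i) R(x,t) = x whenever x ∈ N_p or t = 1, (ii) R(x,0) ∈ N_p for all x ∈ N, and (iii) s(R(x,t)) = s(x) for all x ∈ N and all t > 0. Then the endpoint evaluation map ev₁ : Hol^s_p(N) → N_{>p} is a stratum-preserving homotopy equivalence over P_{>p}: the map σ : N_{>p} → Hol^s_p(N) sending x to the path t ↦ R(x,t) is a stratified map with ev₁ ∘ σ = id, and σ ∘ ev₁ is homotopic to the identity of Hol^s_p(N) through stratum-preserving self-maps. -/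
open Set unitInterval

/-- The clamped affine function `c ↦ min 1 (max 0 (2 c - 1))` on the unit interval. -/
noncomputable def unitInterval.clampedDouble (c : I) : I :=
  projIcc (0 : ℝ) 1 zero_le_one (2 * (c : ℝ) - 1)

@[fun_prop]
lemma unitInterval.continuous_clampedDouble : Continuous unitInterval.clampedDouble :=
  continuous_projIcc.comp (by fun_prop)

@[simp]
lemma unitInterval.clampedDouble_zero : unitInterval.clampedDouble 0 = 0 :=
  projIcc_of_le_left _ (by simp)

@[simp]
lemma unitInterval.clampedDouble_one : unitInterval.clampedDouble 1 = 1 :=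
  projIcc_of_right_le _ (by norm_num)

lemma unitInterval.clampedDouble_symm_eq_zero_or (c : I) :
    unitInterval.clampedDouble (σ c) = 0 ∨ unitInterval.clampedDouble c = 0 := by
  rcases le_total (c : ℝ) (1 / 2) with h | h
  · exact .inr (projIcc_of_le_left _ (by linarith))
  · exact .inl (projIcc_of_le_left _ (by rw [coe_symm_eq]; linarith))

lemma unitInterval.sup_ne_zero_left {t : I} (ht : t ≠ 0) (c : I) : t ⊔ c ≠ 0 := fun h =>
  ht (le_antisymm (h ▸ le_sup_left) nonneg')

open unitInterval in
/-- **Strat-aspiring retractions give homotopy link equivalences.** Given a stratified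
space `N` over `P` with stratification valued in `P_{≥p}` and a continuous
`R : N × [0,1] → N` with `R(x,t) = x` for `x ∈ N_p` or `t = 1`, `R(x,0) ∈ N_p`, and
`s(R(x,t)) = s(x)` for `t > 0`, the endpoint evaluation
`ev₁ : Hol^s_p(N) → N_{>p}` is a stratum-preserving homotopy equivalence: the section
`σ` sending `x` to the path `t ↦ R(x,t)` is a continuous stratified section of `ev₁`,
and `σ ∘ ev₁` is homotopic to the identity through stratum-preserving self-maps. -/
theorem stratHolink_ev_one_equiv {P : Type} [PartialOrder P] {N : Type} [TopologicalSpace N]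
    (s : N → P) (hs : AlexContinuous s) (p : P) (hval : ∀ x : N, p ≤ s x)
    (R : N × I → N) (hR : Continuous R)
    (hfix : ∀ (x : N) (t : I), s x = p → R (x, t) = x)
    (hone : ∀ x : N, R (x, 1) = x)
    (hzero : ∀ x : N, s (R (x, 0)) = p)
    (hstrat : ∀ (x : N) (t : I), t ≠ 0 → s (R (x, t)) = s x) :
    ∃ sec : {x : N // p < s x} → StratHolink s p,
      Continuous sec ∧
      (∀ (x : {x : N // p < s x}) (t : I), ((sec x).1 : C(I, N)) t = R (x.1, t)) ∧
      (∀ x : {x : N // p < s x}, stratHolinkEv1 s p (sec x) = x) ∧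
      (∀ x : {x : N // p < s x}, stratHolinkStrat s p (sec x) = ⟨s x.1, x.2⟩) ∧
      ∃ H : I × StratHolink s p → StratHolink s p,
        Continuous H ∧
        (∀ γ, H (0, γ) = sec (stratHolinkEv1 s p γ)) ∧
        (∀ γ, H (1, γ) = γ) ∧
        ∀ (t : I) (γ), stratHolinkStrat s p (H (t, γ)) = stratHolinkStrat s p γ := by
  have hpos : ∀ (γ : StratHolink s p) (a b : I), a ≠ 0 → b ≠ 0 →
      s (R (γ.1 a, b)) = s (γ.1 1) := fun γ a b ha hb =>
    (hstrat _ b hb).trans (γ.2.2.2 a 1 ha I_one_ne_zero)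
  have hbase : ∀ (γ : StratHolink s p) (a b : I), a = 0 ∨ b = 0 → s (R (γ.1 a, b)) = p := by
    rintro γ a b (rfl | rfl)
    · rw [hfix _ _ γ.2.1, γ.2.1]
    · exact hzero _
  let sec : {x : N // p < s x} → StratHolink s p := fun x =>
    ⟨⟨fun t => R (x.1, t), by fun_prop⟩, hzero _,
      fun t ht => (hstrat x.1 t ht).symm ▸ x.2,
      fun t t' ht ht' => (hstrat x.1 t ht).trans (hstrat x.1 t' ht').symm⟩
  let path : I × StratHolink s p → I → N := fun z t =>
    R (z.2.1 (t ⊔ clampedDouble (σ z.1)), t ⊔ clampedDouble z.1)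
  have hpath : Continuous (Function.uncurry path) := by
    unfold path Function.uncurry
    fun_prop
  have hpath_pos : ∀ (z : I × StratHolink s p) (t : I), t ≠ 0 → s (path z t) = s (z.2.1 1) :=
    fun z t ht => hpos z.2 _ _ (sup_ne_zero_left ht _) (sup_ne_zero_left ht _)
  let H : I × StratHolink s p → StratHolink s p := fun z =>
    ⟨⟨path z, hpath.uncurry_left z⟩,
      hbase z.2 _ _ (by simpa using clampedDouble_symm_eq_zero_or z.1),
      fun t ht => (hpath_pos z t ht).symm ▸ z.2.2.2.1 1 I_one_ne_zero,
      fun t t' ht ht' => (hpath_pos z t ht).trans (hpath_pos z t' ht').symm⟩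
  refine ⟨sec, ?_, fun _ _ => rfl, fun x => Subtype.ext (hone x.1),
    fun x => Subtype.ext (hstrat x.1 1 I_one_ne_zero), H, ?_, fun γ => ?_, fun γ => ?_,
    fun t γ => Subtype.ext (hpath_pos (t, γ) 1 I_one_ne_zero)⟩
  · refine Continuous.subtype_mk (ContinuousMap.continuous_of_continuous_uncurry _ ?_) _
    change Continuous fun z : {x : N // p < s x} × I => R (z.1.1, z.2)
    fun_prop
  · exact Continuous.subtype_mk (ContinuousMap.continuous_of_continuous_uncurry _ hpath) _
  · refine Subtype.ext (ContinuousMap.ext fun t => ?_)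
    change R (γ.1 (t ⊔ clampedDouble (σ 0)), t ⊔ clampedDouble 0) = R (γ.1 1, t)
    simp [sup_of_le_right (le_one' (t := t))]
  · refine Subtype.ext (ContinuousMap.ext fun t => ?_)
    change R (γ.1 (t ⊔ clampedDouble (σ 1)), t ⊔ clampedDouble 1) = γ.1 t
    simp [sup_of_le_right (le_one' (t := t)), hone]
end

section
/- Let X be a stratified space over a poset P, p ∈ P, and I = [p_1 < … < p_n] a regular flag in P_{>p}. Then the generalized homotopy link Holink_I(Hol^s_p(X)), formed with respect to the stratification of Hol^s_p(X) over P_{>p}, is weakly homotopy equivalent to the generalized homotopy link Holink_{[p < p_1 < … < p_n]}(X). -/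
open Set unitInterval

/-! ### Homotopy equivalences are weak homotopy equivalences -/

section Cube

variable {T T' X Y : Type*} {n : ℕ}

/-- Twice the sup-norm distance of a point of the cube from the centre. -/
noncomputable def cubeRadius (y : Fin n → I) : ℝ := 2 * ‖fun i => (y i : ℝ) - 1 / 2‖

lemma continuous_cubeRadius : Continuous (cubeRadius (n := n)) := by
  unfold cubeRadius
  fun_prop

lemma cubeRadius_le_one (y : Fin n → I) : cubeRadius y ≤ 1 := by
  have : ‖fun i => (y i : ℝ) - 1 / 2‖ ≤ 1 / 2 := by
    refine (pi_norm_le_iff_of_nonneg (by norm_num)).2 fun i => ?_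
    rw [Real.norm_eq_abs, abs_le]
    constructor <;> linarith [(y i).2.1, (y i).2.2]
  unfold cubeRadius
  linarith

lemma cubeRadius_of_mem_cubeBoundary {y : Fin n → I} (hy : y ∈ cubeBoundary n) :
    cubeRadius y = 1 := by
  refine le_antisymm (cubeRadius_le_one y) ?_
  obtain ⟨i, hi⟩ := hy
  have h1 := norm_le_pi_norm (fun i => (y i : ℝ) - 1 / 2) i
  have h2 : ‖(y i : ℝ) - 1 / 2‖ = 1 / 2 := by
    rcases hi with hi | hi <;> simp only [hi, Icc.coe_zero, Icc.coe_one] <;> norm_num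
  unfold cubeRadius
  linarith

/-- Dilation of the cube by `1 + u` about its centre, clamped to the cube. -/
noncomputable def cubeDilate (u : I) (y : Fin n → I) : Fin n → I := fun i =>
  projIcc 0 1 zero_le_one (1 / 2 + (1 + (u : ℝ)) * ((y i : ℝ) - 1 / 2))

lemma continuous_cubeDilate :
    Continuous fun z : I × (Fin n → I) => cubeDilate z.1 z.2 :=
  continuous_pi fun i => continuous_projIcc.comp (by fun_prop)

lemma cubeDilate_zero (y : Fin n → I) : cubeDilate 0 y = y := by
  funext i
  simp [cubeDilate]

lemma cubeDilate_mem_cubeBoundary {u : I} {y : Fin n → I}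
    (h : (1 + (u : ℝ)) * cubeRadius y = 1) : cubeDilate u y ∈ cubeBoundary n := by
  have hu : 0 < 1 + (u : ℝ) := by linarith [u.2.1]
  have hr : 0 < cubeRadius y := by
    by_contra! hr
    nlinarith
  obtain ⟨i, hi⟩ : ∃ i, cubeRadius y / 2 ≤ ‖(y i : ℝ) - 1 / 2‖ := by
    by_contra! hlt
    have := (pi_norm_lt_iff (x := fun i => (y i : ℝ) - 1 / 2) (half_pos hr)).2 hlt
    unfold cubeRadius at this
    linarith
  refine ⟨i, ?_⟩
  rw [Real.norm_eq_abs] at hi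
  rcases le_total 0 ((y i : ℝ) - 1 / 2) with h0 | h0
  · rw [abs_of_nonneg h0] at hi
    exact Or.inr (projIcc_of_right_le _ (by nlinarith))
  · rw [abs_of_nonpos h0] at hi
    exact Or.inl (projIcc_of_le_left _ (by nlinarith))

open Classical in
/-- Extension of a family `K` of maps of the cube by a family `N` of paths: `K` is shrunk towards
the centre and the collar is filled in radially by `N`. -/
noncomputable def collarMap (K : T × (Fin n → I) → X) (N : T × I → X)
    (z : T × (Fin n → I) × I) : X :=
  if (1 + (z.2.2 : ℝ)) * cubeRadius z.2.1 ≤ 1 then K (z.1, cubeDilate z.2.2 z.2.1)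
  else N (z.1, projIcc 0 1 zero_le_one ((1 + (z.2.2 : ℝ)) * cubeRadius z.2.1 - 1))

lemma collarMap_zero (K : T × (Fin n → I) → X) (N : T × I → X) (t : T) (y : Fin n → I) :
    collarMap K N (t, y, 0) = K (t, y) := by
  simp [collarMap, cubeRadius_le_one, cubeDilate_zero]

lemma collarMap_of_mem_cubeBoundary {K : T × (Fin n → I) → X} {N : T × I → X}
    (hKN : ∀ t, ∀ y ∈ cubeBoundary n, K (t, y) = N (t, 0)) (t : T) {y : Fin n → I}
    (hy : y ∈ cubeBoundary n) (u : I) : collarMap K N (t, y, u) = N (t, u) := by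
  by_cases hu : u = 0
  · rw [hu, collarMap_zero, hKN t y hy]
  · have hu' : 0 < (u : ℝ) := unitInterval.pos_iff_ne_zero.2 hu
    simp [collarMap, cubeRadius_of_mem_cubeBoundary hy, hu'.not_ge]

lemma collarMap_congr {K : T × (Fin n → I) → X} {N : T × I → X} {K' : T' × (Fin n → I) → X}
    {N' : T' × I → X} {t : T} {t' : T'} (hK : ∀ y, K (t, y) = K' (t', y))
    (hN : ∀ v, N (t, v) = N' (t', v)) (y : Fin n → I) (u : I) :
    collarMap K N (t, y, u) = collarMap K' N' (t', y, u) := by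
  simp [collarMap, hK, hN]

variable [TopologicalSpace T] [TopologicalSpace X] [TopologicalSpace Y]

lemma continuous_collarMap {K : T × (Fin n → I) → X} {N : T × I → X} (hK : Continuous K)
    (hN : Continuous N) (hKN : ∀ t, ∀ y ∈ cubeBoundary n, K (t, y) = N (t, 0)) :
    Continuous (collarMap K N) := by
  have hr : Continuous fun z : T × (Fin n → I) × I => cubeRadius z.2.1 :=
    continuous_cubeRadius.comp (by fun_prop)
  have hd : Continuous fun z : T × (Fin n → I) × I => cubeDilate z.2.2 z.2.1 :=
    continuous_cubeDilate.comp (by fun_prop : Continuous fun z : T × (Fin n → I) × I =>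
      (z.2.2, z.2.1))
  refine Continuous.if_le (hK.comp (by fun_prop))
    (hN.comp (continuous_fst.prodMk (continuous_projIcc.comp (by fun_prop)))) (by fun_prop)
    continuous_const fun z hz => ?_
  rw [hKN _ _ (cubeDilate_mem_cubeBoundary hz), hz, sub_self, projIcc_left]
  rfl

/-- A homotopy of maps of the cube whose restriction to the boundary is the path `γ`. -/
def HomotopicAlong (γ : C(I, X)) (p q : C(Fin n → I, X)) : Prop :=
  ∃ G : C(I × (Fin n → I), X), (∀ y, G (0, y) = p y) ∧ (∀ y, G (1, y) = q y) ∧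
    ∀ t, ∀ y ∈ cubeBoundary n, G (t, y) = γ t

lemma HomotopicAlong.symm {γ : C(I, X)} {p q : C(Fin n → I, X)} (h : HomotopicAlong γ p q) :
    HomotopicAlong (γ.comp ⟨unitInterval.symm, unitInterval.continuous_symm⟩) q p := by
  obtain ⟨G, h0, h1, hb⟩ := h
  refine ⟨G.comp ⟨fun z => (unitInterval.symm z.1, z.2), by fun_prop⟩, fun y => ?_, fun y => ?_,
    fun t y hy => ?_⟩
  · simp [h1]
  · simp [h0]
  · simp [hb _ y hy]

/-- Transport of a map of the cube along a path starting at its boundary value. -/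
noncomputable def cubeTransport (γ : C(I, X)) (p : C(Fin n → I, X))
    (h : ∀ y ∈ cubeBoundary n, p y = γ 0) : C(Fin n → I, X) where
  toFun y := collarMap (fun z : Unit × (Fin n → I) => p z.2) (fun z => γ z.2) ((), y, 1)
  continuous_toFun := (continuous_collarMap (by fun_prop) (by fun_prop)
    fun _ => h).comp (by fun_prop)

lemma cubeTransport_of_mem_cubeBoundary {γ : C(I, X)} {p : C(Fin n → I, X)}
    (h : ∀ y ∈ cubeBoundary n, p y = γ 0) {y : Fin n → I} (hy : y ∈ cubeBoundary n) :
    cubeTransport γ p h y = γ 1 :=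
  collarMap_of_mem_cubeBoundary (K := fun z : Unit × (Fin n → I) => p z.2)
    (N := fun z => γ z.2) (fun _ => h) () hy 1

lemma collarMap_eq_cubeTransport {S : Type*} {γ : C(I, X)} {p : C(Fin n → I, X)}
    (h : ∀ y ∈ cubeBoundary n, p y = γ 0) {K : S × (Fin n → I) → X} {N : S × I → X} {t : S}
    (hK : ∀ y, K (t, y) = p y) (hN : ∀ v, N (t, v) = γ v) (y : Fin n → I) :
    collarMap K N (t, y, 1) = cubeTransport γ p h y :=
  collarMap_congr (K' := fun z : Unit × (Fin n → I) => p z.2) (N' := fun z => γ z.2) (t' := ())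
    hK hN y 1

lemma homotopicAlong_cubeTransport (γ : C(I, X)) (p : C(Fin n → I, X))
    (h : ∀ y ∈ cubeBoundary n, p y = γ 0) : HomotopicAlong γ p (cubeTransport γ p h) := by
  refine ⟨⟨fun z => collarMap (fun z : Unit × (Fin n → I) => p z.2) (fun z => γ z.2)
    ((), z.2, z.1), (continuous_collarMap (by fun_prop) (by fun_prop)
    fun _ => h).comp (by fun_prop)⟩, fun y =>
      collarMap_zero (fun z : Unit × (Fin n → I) => p z.2) (fun z => γ z.2) () y, fun y => rfl,
    fun t y hy => collarMap_of_mem_cubeBoundary (K := fun z : Unit × (Fin n → I) => p z.2)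
      (N := fun z => γ z.2) (fun _ => h) () hy t⟩

lemma cubeTransport_homotopicRel {γ : C(I, X)} {p p' : C(Fin n → I, X)}
    (hp : ∀ y ∈ cubeBoundary n, p y = γ 0) (hp' : ∀ y ∈ cubeBoundary n, p' y = γ 0)
    (h : p.HomotopicRel p' (cubeBoundary n)) :
    (cubeTransport γ p hp).HomotopicRel (cubeTransport γ p' hp') (cubeBoundary n) := by
  obtain ⟨F⟩ := h
  have hF : ∀ t, ∀ y ∈ cubeBoundary n, F (t, y) = γ 0 := fun t y hy =>
    (F.eq_fst t hy).trans (hp y hy)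
  refine ⟨⟨⟨⟨fun z => collarMap (fun z : I × (Fin n → I) => F z) (fun z => γ z.2)
    (z.1, z.2, 1), (continuous_collarMap (by fun_prop) (by fun_prop) hF).comp
      (by fun_prop)⟩, fun y => ?_, fun y => ?_⟩, fun t y hy => ?_⟩⟩
  · exact collarMap_eq_cubeTransport (K := fun z : I × (Fin n → I) => F z)
      (N := fun z => γ z.2) hp (fun y => F.apply_zero y) (fun _ => rfl) y
  · exact collarMap_eq_cubeTransport (K := fun z : I × (Fin n → I) => F z)
      (N := fun z => γ z.2) hp' (fun y => F.apply_one y) (fun _ => rfl) y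
  · exact (collarMap_of_mem_cubeBoundary (K := fun z : I × (Fin n → I) => F z)
      (N := fun z => γ z.2) hF t hy 1).trans (cubeTransport_of_mem_cubeBoundary hp hy).symm

lemma HomotopicAlong.cubeTransport_homotopicRel {γ : C(I, X)} {p q : C(Fin n → I, X)}
    (h : HomotopicAlong γ p q) (hp : ∀ y ∈ cubeBoundary n, p y = γ 0) :
    (cubeTransport γ p hp).HomotopicRel q (cubeBoundary n) := by
  obtain ⟨G, h0, h1, hb⟩ := h
  have hq : ∀ y ∈ cubeBoundary n, q y = ContinuousMap.const I (γ 1) 0 := fun y hy => by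
    rw [← h1, hb 1 y hy, ContinuousMap.const_apply]
  have hG : ∀ t, ∀ y ∈ cubeBoundary n, G (t, y) = γ (max t 0) := fun t y hy => by
    rw [hb t y hy, show max t 0 = t from max_eq_left t.2.1]
  have first : (cubeTransport γ p hp).HomotopicRel
      (cubeTransport (ContinuousMap.const I (γ 1)) q hq) (cubeBoundary n) := by
    refine ⟨⟨⟨⟨fun z => collarMap (fun z : I × (Fin n → I) => G z) (fun z => γ (max z.1 z.2))
      (z.1, z.2, 1), (continuous_collarMap (by fun_prop) (by fun_prop) hG).comp
        (by fun_prop)⟩, fun y => ?_, fun y => ?_⟩, fun t y hy => ?_⟩⟩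
    · exact collarMap_eq_cubeTransport (K := fun z : I × (Fin n → I) => G z)
        (N := fun z => γ (max z.1 z.2)) hp h0 (fun v => congrArg γ (max_eq_right v.2.1)) y
    · exact collarMap_eq_cubeTransport (K := fun z : I × (Fin n → I) => G z)
        (N := fun z => γ (max z.1 z.2)) hq h1 (fun v => congrArg γ (max_eq_left v.2.2)) y
    · refine (collarMap_of_mem_cubeBoundary (K := fun z : I × (Fin n → I) => G z)
        (N := fun z => γ (max z.1 z.2)) hG t hy 1).trans ?_
      rw [cubeTransport_of_mem_cubeBoundary hp hy]
      exact congrArg γ (max_eq_right t.2.2)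
  refine first.trans (ContinuousMap.HomotopicRel.symm ?_)
  obtain ⟨G', h0', h1', hb'⟩ := homotopicAlong_cubeTransport (ContinuousMap.const I (γ 1)) q hq
  exact ⟨⟨⟨G', h0', h1'⟩, fun t y hy => (hb' t y hy).trans (hq y hy).symm⟩⟩

lemma htpyGroupMap_bijective_of_homotopic_id {φ : C(X, X)}
    (h : (ContinuousMap.id X).Homotopic φ) (n : ℕ) (x : X) :
    Function.Bijective (htpyGroupMap n φ x) := by
  obtain ⟨H⟩ := h
  let γ : C(I, X) := ⟨fun t => H (t, x), by fun_prop⟩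
  have hγ0 : γ 0 = x := H.apply_zero x
  have hγ1 : γ 1 = φ x := H.apply_one x
  have along (p : GenLoops n X x) : HomotopicAlong γ p.1 (φ.comp p.1) := by
    refine ⟨⟨fun z => H (z.1, p.1 z.2), by fun_prop⟩, fun y => ?_, fun y => ?_, fun t y hy => ?_⟩
    · simp
    · simp
    · simp [γ, p.2 y hy]
  constructor
  · intro a b
    induction a using Quotient.inductionOn with | _ p
    induction b using Quotient.inductionOn with | _ q
    intro hpq
    have hpq : (φ.comp p.1).HomotopicRel (φ.comp q.1) (cubeBoundary n) := Quotient.exact hpq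
    have hb (p : GenLoops n X x) : ∀ y ∈ cubeBoundary n, φ.comp p.1 y =
        γ.comp ⟨unitInterval.symm, unitInterval.continuous_symm⟩ 0 := fun y hy => by
      simp [p.2 y hy, hγ1]
    exact Quotient.sound
      (((along p).symm.cubeTransport_homotopicRel (hb p)).symm.trans
        ((cubeTransport_homotopicRel (hb p) (hb q) hpq).trans
          ((along q).symm.cubeTransport_homotopicRel (hb q))))
  · intro b
    induction b using Quotient.inductionOn with | _ q
    have hq : ∀ y ∈ cubeBoundary n, q.1 y =
        γ.comp ⟨unitInterval.symm, unitInterval.continuous_symm⟩ 0 := fun y hy => by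
      simp [q.2 y hy, hγ1]
    let p : GenLoops n X x := ⟨cubeTransport _ q.1 hq, fun y hy => by
      rw [cubeTransport_of_mem_cubeBoundary hq hy]
      simp [hγ0]⟩
    have hp : ∀ y ∈ cubeBoundary n, p.1 y = γ 0 := fun y hy => (p.2 y hy).trans hγ0.symm
    have hqp : HomotopicAlong γ p.1 q.1 := by
      have := (homotopicAlong_cubeTransport _ q.1 hq).symm
      rwa [ContinuousMap.comp_assoc, show ContinuousMap.comp
        (⟨unitInterval.symm, unitInterval.continuous_symm⟩ : C(I, I))
        ⟨unitInterval.symm, unitInterval.continuous_symm⟩ = ContinuousMap.id I from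
          ContinuousMap.ext unitInterval.symm_symm, ContinuousMap.comp_id] at this
    exact ⟨Quotient.mk _ p, Quotient.sound (((along p).cubeTransport_homotopicRel hp).symm.trans
      (hqp.cubeTransport_homotopicRel hp))⟩

lemma pi0Map_eq_id_of_homotopic_id {φ : C(X, X)}
    (h : (ContinuousMap.id X).Homotopic φ) (a : ZerothHomotopy X) : pi0Map φ a = a := by
  obtain ⟨H⟩ := h
  induction a using Quotient.inductionOn with | _ x
  exact Quotient.sound ⟨(H.evalAt x).symm⟩

/-- A homotopy equivalence is a weak homotopy equivalence. -/
lemma isWeakHomotopyEquiv_of_homotopic_id (f : C(X, Y)) (g : C(Y, X))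
    (hgf : (ContinuousMap.id X).Homotopic (g.comp f))
    (hfg : (ContinuousMap.id Y).Homotopic (f.comp g)) : IsWeakHomotopyEquiv f := by
  refine ⟨⟨Function.LeftInverse.injective (g := pi0Map g) fun a => ?_,
    Function.RightInverse.surjective (g := pi0Map g) fun a => ?_⟩, fun n x => ?_⟩
  · refine Eq.trans ?_ (pi0Map_eq_id_of_homotopic_id hgf a)
    induction a using Quotient.inductionOn with | _ x
    rfl
  · refine Eq.trans ?_ (pi0Map_eq_id_of_homotopic_id hfg a)
    induction a using Quotient.inductionOn with | _ x
    rfl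
  · have h1 : Function.Bijective (htpyGroupMap (n + 1) g (f x) ∘ htpyGroupMap (n + 1) f x) := by
      refine (congrArg Function.Bijective ?_).mpr
        (htpyGroupMap_bijective_of_homotopic_id hgf (n + 1) x)
      funext a
      induction a using Quotient.inductionOn with | _ p
      rfl
    have h2 : Function.Bijective
        (htpyGroupMap (n + 1) f (g (f x)) ∘ htpyGroupMap (n + 1) g (f x)) := by
      refine (congrArg Function.Bijective ?_).mpr
        (htpyGroupMap_bijective_of_homotopic_id hfg (n + 1) (f x))
      funext a
      induction a using Quotient.inductionOn with | _ p
      rfl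
    exact (Function.Bijective.of_comp_iff' ⟨h2.1.of_comp, h1.2.of_comp⟩ _).1 h1

end Cube

/-! ### The join of a vertex with a simplex -/

section Cone

variable {P : Type*} {m : ℕ}

lemma maxSupp_pos (x : stdSimplex ℝ (Fin (m + 1))) :
    0 < (x : Fin (m + 1) → ℝ) (maxSupp x) :=
  (Finset.mem_filter.1 (Finset.max'_mem (Finset.univ.filter fun i =>
    0 < (x : Fin (m + 1) → ℝ) i) _)).2

lemma eq_zero_of_maxSupp_lt {x : stdSimplex ℝ (Fin (m + 1))} {i : Fin (m + 1)}
    (hi : maxSupp x < i) : (x : Fin (m + 1) → ℝ) i = 0 := by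
  refine le_antisymm (not_lt.1 fun h => hi.not_ge ?_) (x.2.1 i)
  exact Finset.le_max' _ _ (Finset.mem_filter.2 ⟨Finset.mem_univ i, h⟩)

lemma maxSupp_eq {x : stdSimplex ℝ (Fin (m + 1))} {i : Fin (m + 1)}
    (hi : 0 < (x : Fin (m + 1) → ℝ) i) (h : ∀ j, i < j → (x : Fin (m + 1) → ℝ) j = 0) :
    maxSupp x = i := by
  rcases lt_trichotomy (maxSupp x) i with hlt | heq | hlt
  · exact absurd (eq_zero_of_maxSupp_lt hlt) hi.ne'
  · exact heq
  · exact absurd (h _ hlt) (maxSupp_pos x).ne'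

/-- The point at parameter `t` on the segment from the zeroth vertex to the point `x` of the
opposite face. -/
def simplexCone (t : I) (x : stdSimplex ℝ (Fin (m + 1))) : stdSimplex ℝ (Fin (m + 2)) :=
  ⟨Fin.cons (1 - (t : ℝ)) fun i => (t : ℝ) * (x : Fin (m + 1) → ℝ) i, by
    constructor
    · intro j
      cases j using Fin.cases with
      | zero => exact sub_nonneg.2 t.2.2
      | succ i => exact mul_nonneg t.2.1 (x.2.1 i)
    · rw [Fin.sum_univ_succ]
      simp only [Fin.cons_zero, Fin.cons_succ, ← Finset.mul_sum, stdSimplex.sum_eq_one]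
      ring⟩

@[simp] lemma simplexCone_zero (t : I) (x : stdSimplex ℝ (Fin (m + 1))) :
    (simplexCone t x : Fin (m + 2) → ℝ) 0 = 1 - (t : ℝ) := rfl

@[simp] lemma simplexCone_succ (t : I) (x : stdSimplex ℝ (Fin (m + 1))) (i : Fin (m + 1)) :
    (simplexCone t x : Fin (m + 2) → ℝ) i.succ = (t : ℝ) * (x : Fin (m + 1) → ℝ) i := rfl

@[fun_prop]
lemma continuous_coord {n : ℕ} (i : Fin n) :
    Continuous fun x : stdSimplex ℝ (Fin n) => (x : Fin n → ℝ) i :=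
  (continuous_apply i).comp continuous_subtype_val

lemma continuous_stdSimplex_of_coord {Z : Type*} [TopologicalSpace Z] {n : ℕ}
    {f : Z → stdSimplex ℝ (Fin n)} (h : ∀ i, Continuous fun z => (f z : Fin n → ℝ) i) :
    Continuous f :=
  continuous_induced_rng.2 (continuous_pi h)

lemma continuous_simplexCone :
    Continuous fun z : I × stdSimplex ℝ (Fin (m + 1)) => simplexCone z.1 z.2 := by
  refine continuous_stdSimplex_of_coord (Fin.cases ?_ fun i => ?_)
  · simp only [simplexCone_zero]
    fun_prop
  · simp only [simplexCone_succ]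
    exact (continuous_subtype_val.comp continuous_fst).mul
      ((continuous_coord i).comp continuous_snd)

lemma maxSupp_simplexCone_zero (x : stdSimplex ℝ (Fin (m + 1))) :
    maxSupp (simplexCone 0 x) = 0 :=
  maxSupp_eq (by simp) (Fin.cases (fun h => absurd h (lt_irrefl _)) fun i _ => by simp)

lemma maxSupp_simplexCone {t : I} (ht : t ≠ 0) (x : stdSimplex ℝ (Fin (m + 1))) :
    maxSupp (simplexCone t x) = (maxSupp x).succ := by
  refine maxSupp_eq ?_ (Fin.cases (fun h => absurd h (Fin.not_lt_zero _)) fun i hi => ?_)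
  · exact mul_pos (unitInterval.pos_iff_ne_zero.2 ht) (maxSupp_pos x)
  · simp [eq_zero_of_maxSupp_lt (Fin.succ_lt_succ_iff.1 hi)]

/-- The straight-line motion of a simplex towards its zeroth vertex. -/
def simplexPush (a : I) (x : stdSimplex ℝ (Fin (m + 1))) : stdSimplex ℝ (Fin (m + 1)) :=
  ⟨fun i => (a : ℝ) * (x : Fin (m + 1) → ℝ) i + (1 - (a : ℝ)) * (Pi.single 0 1 : Fin (m + 1) → ℝ) i,
    (convex_stdSimplex ℝ _) x.2 (single_mem_stdSimplex ℝ 0) a.2.1 (sub_nonneg.2 a.2.2)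
      (by ring)⟩

lemma simplexPush_apply (a : I) (x : stdSimplex ℝ (Fin (m + 1))) (i : Fin (m + 1)) :
    (simplexPush a x : Fin (m + 1) → ℝ) i =
      (a : ℝ) * (x : Fin (m + 1) → ℝ) i + (1 - (a : ℝ)) * (Pi.single 0 1 : Fin (m + 1) → ℝ) i :=
  rfl

lemma continuous_simplexPush :
    Continuous fun z : I × stdSimplex ℝ (Fin (m + 1)) => simplexPush z.1 z.2 :=
  continuous_stdSimplex_of_coord fun i => by
    have h1 : Continuous fun z : I × stdSimplex ℝ (Fin (m + 1)) => (z.2 : Fin (m + 1) → ℝ) i :=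
      (continuous_coord i).comp continuous_snd
    change Continuous fun z : I × stdSimplex ℝ (Fin (m + 1)) => (z.1 : ℝ) * _ + (1 - (z.1 : ℝ)) * _
    fun_prop

lemma simplexPush_one (x : stdSimplex ℝ (Fin (m + 1))) : simplexPush 1 x = x :=
  stdSimplex.ext (funext fun i => by simp [simplexPush_apply])

lemma maxSupp_simplexPush {a : I} (ha : a ≠ 0) (x : stdSimplex ℝ (Fin (m + 1))) :
    maxSupp (simplexPush a x) = maxSupp x := by
  refine maxSupp_eq ?_ fun j hj => ?_
  · refine add_pos_of_pos_of_nonneg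
      (mul_pos (unitInterval.pos_iff_ne_zero.2 ha) (maxSupp_pos x))
      (mul_nonneg (sub_nonneg.2 a.2.2) ((single_mem_stdSimplex ℝ 0).1 _))
  · simp [simplexPush_apply, eq_zero_of_maxSupp_lt hj, (lt_of_le_of_lt (Fin.zero_le _) hj).ne']

/-- The distance from the zeroth vertex. -/
def simplexHeight (y : stdSimplex ℝ (Fin (m + 2))) : I :=
  ⟨1 - (y : Fin (m + 2) → ℝ) 0, by
    constructor <;> linarith [stdSimplex.zero_le y 0, stdSimplex.le_one y 0]⟩

lemma continuous_simplexHeight : Continuous (simplexHeight (m := m)) :=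
  Continuous.subtype_mk (by fun_prop) _

/-- The degeneracy merging the first two vertices. -/
def simplexDegeneracy (y : stdSimplex ℝ (Fin (m + 2))) : stdSimplex ℝ (Fin (m + 1)) :=
  ⟨fun i => (y : Fin (m + 2) → ℝ) i.succ + (y : Fin (m + 2) → ℝ) 0 *
      (Pi.single 0 1 : Fin (m + 1) → ℝ) i, by
    refine ⟨fun i => add_nonneg (y.2.1 _)
      (mul_nonneg (y.2.1 _) ((single_mem_stdSimplex ℝ 0).1 _)), ?_⟩
    have h := y.2.2
    rw [Fin.sum_univ_succ] at h
    rw [Finset.sum_add_distrib, ← Finset.mul_sum, (single_mem_stdSimplex ℝ 0).2, mul_one, add_comm]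
    exact h⟩

lemma simplexDegeneracy_apply (y : stdSimplex ℝ (Fin (m + 2))) (i : Fin (m + 1)) :
    (simplexDegeneracy y : Fin (m + 1) → ℝ) i = (y : Fin (m + 2) → ℝ) i.succ +
      (y : Fin (m + 2) → ℝ) 0 * (Pi.single 0 1 : Fin (m + 1) → ℝ) i := rfl

lemma continuous_simplexDegeneracy : Continuous (simplexDegeneracy (m := m)) :=
  continuous_stdSimplex_of_coord fun i => by
    change Continuous fun y : stdSimplex ℝ (Fin (m + 2)) => (_ + _ : ℝ)
    fun_prop

lemma simplexDegeneracy_simplexCone (t : I) (x : stdSimplex ℝ (Fin (m + 1))) :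
    simplexDegeneracy (simplexCone t x) = simplexPush t x := rfl

lemma simplexHeight_simplexCone (t : I) (x : stdSimplex ℝ (Fin (m + 1))) :
    simplexHeight (simplexCone t x) = t :=
  Subtype.ext (sub_sub_cancel 1 (t : ℝ))

lemma simplexHeight_eq_zero_iff (y : stdSimplex ℝ (Fin (m + 2))) :
    simplexHeight y = 0 ↔ maxSupp y = 0 := by
  have hsum := stdSimplex.sum_eq_one y
  rw [Fin.sum_univ_succ] at hsum
  constructor
  · intro h
    have h0 : 1 - (y : Fin (m + 2) → ℝ) 0 = 0 := congrArg Subtype.val h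
    have hs : ∑ i : Fin (m + 1), (y : Fin (m + 2) → ℝ) i.succ = 0 := by linarith
    have hs := (Finset.sum_eq_zero_iff_of_nonneg fun i _ => y.2.1 i.succ).1 hs
    exact maxSupp_eq (by linarith)
      (Fin.cases (fun h => absurd h (lt_irrefl _)) fun i _ => hs i (Finset.mem_univ i))
  · intro h
    have hs : ∑ i : Fin (m + 1), (y : Fin (m + 2) → ℝ) i.succ = 0 :=
      Finset.sum_eq_zero fun i _ => eq_zero_of_maxSupp_lt (h ▸ Fin.succ_pos i)
    refine Subtype.ext ?_
    change 1 - (y : Fin (m + 2) → ℝ) 0 = 0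
    linarith

lemma succ_maxSupp_simplexDegeneracy {y : stdSimplex ℝ (Fin (m + 2))}
    (hy : maxSupp y ≠ 0) : (maxSupp (simplexDegeneracy y)).succ = maxSupp y := by
  obtain ⟨k, hk⟩ := Fin.exists_succ_eq.2 hy
  rw [← hk]
  congr 1
  refine maxSupp_eq ?_ fun j hj => ?_
  · refine add_pos_of_pos_of_nonneg (hk ▸ maxSupp_pos y)
      (mul_nonneg (y.2.1 _) ((single_mem_stdSimplex ℝ 0).1 _))
  · simp [simplexDegeneracy_apply, eq_zero_of_maxSupp_lt (hk ▸ Fin.succ_lt_succ_iff.2 hj),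
      (lt_of_le_of_lt (Fin.zero_le _) hj).ne']

lemma maxSupp_simplexCone_simplexDegeneracy (y : stdSimplex ℝ (Fin (m + 2))) :
    maxSupp (simplexCone (simplexHeight y) (simplexDegeneracy y)) = maxSupp y := by
  by_cases hy : maxSupp y = 0
  · rw [(simplexHeight_eq_zero_iff y).2 hy, maxSupp_simplexCone_zero, hy]
  · rw [maxSupp_simplexCone (mt (simplexHeight_eq_zero_iff y).1 hy),
      succ_maxSupp_simplexDegeneracy hy]

/-- The point at parameter `u` on the segment between two points of a simplex. -/
def simplexSegment (u : I) (x y : stdSimplex ℝ (Fin (m + 1))) : stdSimplex ℝ (Fin (m + 1)) :=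
  ⟨fun i => (1 - (u : ℝ)) * (x : Fin (m + 1) → ℝ) i + (u : ℝ) * (y : Fin (m + 1) → ℝ) i,
    (convex_stdSimplex ℝ _) x.2 y.2 (sub_nonneg.2 u.2.2) u.2.1 (by ring)⟩

lemma simplexSegment_apply (u : I) (x y : stdSimplex ℝ (Fin (m + 1))) (i : Fin (m + 1)) :
    (simplexSegment u x y : Fin (m + 1) → ℝ) i =
      (1 - (u : ℝ)) * (x : Fin (m + 1) → ℝ) i + (u : ℝ) * (y : Fin (m + 1) → ℝ) i := rfl

lemma continuous_simplexSegment :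
    Continuous fun z : I × stdSimplex ℝ (Fin (m + 1)) × stdSimplex ℝ (Fin (m + 1)) =>
      simplexSegment z.1 z.2.1 z.2.2 :=
  continuous_stdSimplex_of_coord fun i => by
    have h1 : Continuous fun z : I × stdSimplex ℝ (Fin (m + 1)) × stdSimplex ℝ (Fin (m + 1)) =>
        (z.2.1 : Fin (m + 1) → ℝ) i := (continuous_coord i).comp (by fun_prop)
    have h2 : Continuous fun z : I × stdSimplex ℝ (Fin (m + 1)) × stdSimplex ℝ (Fin (m + 1)) =>
        (z.2.2 : Fin (m + 1) → ℝ) i := (continuous_coord i).comp (by fun_prop)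
    change Continuous fun z : I × stdSimplex ℝ (Fin (m + 1)) × stdSimplex ℝ (Fin (m + 1)) =>
      (1 - (z.1 : ℝ)) * _ + (z.1 : ℝ) * _
    fun_prop

lemma simplexSegment_zero (x y : stdSimplex ℝ (Fin (m + 1))) : simplexSegment 0 x y = x :=
  stdSimplex.ext (funext fun i => by simp [simplexSegment_apply])

lemma simplexSegment_one (x y : stdSimplex ℝ (Fin (m + 1))) : simplexSegment 1 x y = y :=
  stdSimplex.ext (funext fun i => by simp [simplexSegment_apply])

lemma maxSupp_simplexSegment (u : I) {x y : stdSimplex ℝ (Fin (m + 1))}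
    (h : maxSupp y = maxSupp x) : maxSupp (simplexSegment u x y) = maxSupp x := by
  refine maxSupp_eq ?_ fun j hj => ?_
  · have hx := maxSupp_pos x
    have hy := maxSupp_pos y
    rw [h] at hy
    exact (convex_Ioi (0 : ℝ)) hx hy (sub_nonneg.2 u.2.2) u.2.1 (by ring)
  · simp [simplexSegment_apply, eq_zero_of_maxSupp_lt hj, eq_zero_of_maxSupp_lt (h ▸ hj)]

end Cone

/-! ### Comparison of homotopy links -/

section Comparison

variable {P X Z : Type*} [TopologicalSpace X] [TopologicalSpace Z] {s : X → P} {m : ℕ}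

lemma continuous_holink_of_uncurry {J : Fin (m + 1) → P} {F : Z → Holink s J}
    (h : Continuous fun z : Z × stdSimplex ℝ (Fin (m + 1)) => (F z.1).1 z.2) : Continuous F :=
  continuous_induced_rng.2 (ContinuousMap.continuous_of_continuous_uncurry _ h)

lemma continuous_holink_eval (J : Fin (m + 1) → P) :
    Continuous fun z : Holink s J × stdSimplex ℝ (Fin (m + 1)) => z.1.1 z.2 :=
  ContinuousEval.continuous_eval.comp
    ((continuous_subtype_val.comp continuous_fst).prodMk continuous_snd)

variable [PartialOrder P] {p : P}

lemma continuous_stratHolink_of_uncurry {F : Z → StratHolink s p}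
    (h : Continuous fun z : Z × I => (F z.1).1 z.2) : Continuous F :=
  continuous_induced_rng.2 (ContinuousMap.continuous_of_continuous_uncurry _ h)

lemma continuous_stratHolink_eval :
    Continuous fun z : StratHolink s p × I => z.1.1 z.2 :=
  ContinuousEval.continuous_eval.comp
    ((continuous_subtype_val.comp continuous_fst).prodMk continuous_snd)

lemma stratHolinkStrat_eq (γ : StratHolink s p) {t : I} (ht : t ≠ 0) :
    s (γ.1 t) = (stratHolinkStrat s p γ).1 :=
  γ.2.2.2 t 1 ht I_one_ne_zero

variable {J : Fin (m + 1) → P} (hJ : ∀ i, p < J i)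

/-- The flag in `P_{>p}` underlying a flag of elements above `p`. -/
abbrev upperFlag (i : Fin (m + 1)) : {q : P // p < q} := ⟨J i, hJ i⟩

/-- Restriction of a map on the cone over a simplex to its rulings. -/
def coneRulings (g : Holink s (Fin.cons p J : Fin (m + 2) → P))
    (x : stdSimplex ℝ (Fin (m + 1))) : StratHolink s p :=
  have h0 : s (g.1 (simplexCone 0 x)) = p := by
    rw [g.2, flagStrat, maxSupp_simplexCone_zero, Fin.cons_zero]
  have h1 {t : I} (ht : t ≠ 0) : s (g.1 (simplexCone t x)) = J (maxSupp x) := by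
    rw [g.2, flagStrat, maxSupp_simplexCone ht, Fin.cons_succ]
  ⟨⟨fun t => g.1 (simplexCone t x), g.1.continuous.comp
      (continuous_simplexCone.comp (by fun_prop : Continuous fun t : I => (t, x)))⟩,
    h0, fun _ ht => (hJ _).trans_eq (h1 ht).symm, fun _ _ ht ht' => (h1 ht).trans (h1 ht').symm⟩

/-- A family of exit paths parametrized by a simplex, as a map on the cone. -/
def ofRulings (h : Holink (stratHolinkStrat s p) (upperFlag hJ))
    (y : stdSimplex ℝ (Fin (m + 2))) : X :=
  (h.1 (simplexDegeneracy y)).1 (simplexHeight y)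

variable (s) in
/-- The comparison map from the homotopy link of `[p < J]` to the iterated homotopy link. -/
def holinkToIterated : C(Holink s (Fin.cons p J : Fin (m + 2) → P),
    Holink (stratHolinkStrat s p) (upperFlag hJ)) where
  toFun g := ⟨⟨coneRulings hJ g, continuous_stratHolink_of_uncurry <| g.1.continuous.comp <|
      continuous_simplexCone.comp continuous_swap⟩, fun x => Subtype.ext <| by
        change s (g.1 (simplexCone 1 x)) = J (maxSupp x)
        rw [g.2, flagStrat, maxSupp_simplexCone I_one_ne_zero, Fin.cons_succ]⟩
  continuous_toFun := continuous_holink_of_uncurry <| continuous_stratHolink_of_uncurry <|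
    (continuous_holink_eval _).comp <| (continuous_fst.comp continuous_fst).prodMk <|
      continuous_simplexCone.comp <| continuous_snd.prodMk (continuous_snd.comp continuous_fst)

variable (s) in
/-- The comparison map from the iterated homotopy link to the homotopy link of `[p < J]`. -/
def holinkOfIterated : C(Holink (stratHolinkStrat s p) (upperFlag hJ),
    Holink s (Fin.cons p J : Fin (m + 2) → P)) where
  toFun h := ⟨⟨ofRulings hJ h, continuous_stratHolink_eval.comp <|
      (h.1.continuous.comp continuous_simplexDegeneracy).prodMk continuous_simplexHeight⟩,
    fun y => by
      change s ((h.1 (simplexDegeneracy y)).1 (simplexHeight y)) = (Fin.cons p J : _ → P) (maxSupp y)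
      by_cases hy : maxSupp y = 0
      · rw [(simplexHeight_eq_zero_iff y).2 hy, hy, Fin.cons_zero]
        exact (h.1 _).2.1
      · rw [stratHolinkStrat_eq (s := s) _ (mt (simplexHeight_eq_zero_iff y).1 hy), h.2,
          ← succ_maxSupp_simplexDegeneracy hy, Fin.cons_succ]
        rfl⟩
  continuous_toFun := continuous_holink_of_uncurry <| continuous_stratHolink_eval.comp <|
    ((continuous_holink_eval _).comp <| continuous_fst.prodMk <|
      continuous_simplexDegeneracy.comp continuous_snd).prodMk <|
        continuous_simplexHeight.comp continuous_snd

lemma holinkOfIterated_comp_holinkToIterated_homotopic :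
    (ContinuousMap.id _).Homotopic ((holinkOfIterated s hJ).comp (holinkToIterated s hJ)) := by
  let r (y : stdSimplex ℝ (Fin (m + 2))) := simplexCone (simplexHeight y) (simplexDegeneracy y)
  have hr : Continuous r := continuous_simplexCone.comp
    (continuous_simplexHeight.prodMk continuous_simplexDegeneracy)
  have hseg : Continuous fun z : I × stdSimplex ℝ (Fin (m + 2)) =>
      simplexSegment z.1 z.2 (r z.2) := continuous_simplexSegment.comp
    (continuous_fst.prodMk (continuous_snd.prodMk (hr.comp continuous_snd)))
  refine ⟨⟨⟨fun z => ⟨⟨fun y => z.2.1 (simplexSegment z.1 y (r y)), z.2.1.continuous.comp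
    (hseg.comp (by fun_prop : Continuous fun y => (z.1, y)))⟩, fun y => ?_⟩, ?_⟩,
    fun g => ?_, fun g => ?_⟩⟩
  · change s (z.2.1 _) = _
    rw [z.2.2, flagStrat, maxSupp_simplexSegment _ (maxSupp_simplexCone_simplexDegeneracy y),
      flagStrat]
  · exact continuous_holink_of_uncurry <| (continuous_holink_eval _).comp <|
      (continuous_snd.comp continuous_fst).prodMk <| hseg.comp <|
        (continuous_fst.comp continuous_fst).prodMk continuous_snd
  · exact Subtype.ext <| ContinuousMap.ext fun y => congrArg g.1 (simplexSegment_zero _ _)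
  · exact Subtype.ext <| ContinuousMap.ext fun y => congrArg g.1 (simplexSegment_one _ _)

/-- Push time along the ruling with parameter `t`, interpolating from `1` at `u = 0` to `t` at
`u = 1`. -/
def pushTime (u t : I) : I := unitInterval.symm (u * unitInterval.symm t)

lemma continuous_pushTime : Continuous fun z : I × I => pushTime z.1 z.2 := by
  unfold pushTime
  fun_prop

lemma pushTime_zero (t : I) : pushTime 0 t = 1 := by simp [pushTime]

lemma pushTime_one (t : I) : pushTime 1 t = t := by simp [pushTime]

lemma pushTime_ne_zero (u : I) {t : I} (ht : t ≠ 0) : pushTime u t ≠ 0 := by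
  intro h
  have h : 1 - (u : ℝ) * (1 - (t : ℝ)) = 0 := congrArg Subtype.val h
  have ht : 0 < (t : ℝ) := unitInterval.pos_iff_ne_zero.2 ht
  nlinarith [mul_nonneg (sub_nonneg.2 u.2.2) (sub_nonneg.2 t.2.2)]

/-- The rulings obtained from a family of exit paths by pushing the parameter of the family
towards the zeroth vertex. -/
def pushedRuling (h : Holink (stratHolinkStrat s p) (upperFlag hJ)) (u : I)
    (x : stdSimplex ℝ (Fin (m + 1))) (t : I) : X :=
  (h.1 (simplexPush (pushTime u t) x)).1 t

lemma continuous_pushedRuling :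
    Continuous fun z : ((I × Holink (stratHolinkStrat s p) (upperFlag hJ)) ×
      stdSimplex ℝ (Fin (m + 1))) × I => pushedRuling hJ z.1.1.2 z.1.1.1 z.1.2 z.2 := by
  have hu : Continuous fun z : ((I × Holink (stratHolinkStrat s p) (upperFlag hJ)) ×
      stdSimplex ℝ (Fin (m + 1))) × I => z.1.1.1 :=
    continuous_fst.comp (continuous_fst.comp continuous_fst)
  have hh : Continuous fun z : ((I × Holink (stratHolinkStrat s p) (upperFlag hJ)) ×
      stdSimplex ℝ (Fin (m + 1))) × I => z.1.1.2 :=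
    continuous_snd.comp (continuous_fst.comp continuous_fst)
  have hx : Continuous fun z : ((I × Holink (stratHolinkStrat s p) (upperFlag hJ)) ×
      stdSimplex ℝ (Fin (m + 1))) × I => z.1.2 := continuous_snd.comp continuous_fst
  exact continuous_stratHolink_eval.comp <| ((continuous_holink_eval _).comp <|
    hh.prodMk <| continuous_simplexPush.comp <|
      (continuous_pushTime.comp (hu.prodMk continuous_snd)).prodMk hx).prodMk continuous_snd

lemma strat_pushedRuling (h : Holink (stratHolinkStrat s p) (upperFlag hJ)) (u : I)
    (x : stdSimplex ℝ (Fin (m + 1))) {t : I} (ht : t ≠ 0) :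
    s (pushedRuling hJ h u x t) = J (maxSupp x) := by
  rw [pushedRuling, stratHolinkStrat_eq (s := s) _ ht, h.2, flagStrat,
    maxSupp_simplexPush (pushTime_ne_zero u ht)]

/-- The family of exit paths with rulings `pushedRuling`. -/
def pushRulings (z : I × Holink (stratHolinkStrat s p) (upperFlag hJ)) :
    Holink (stratHolinkStrat s p) (upperFlag hJ) :=
  ⟨⟨fun x => ⟨⟨pushedRuling hJ z.2 z.1 x, (continuous_pushedRuling hJ).comp
        (continuous_const.prodMk continuous_id : Continuous fun t : I => ((z, x), t))⟩,
      (z.2.1 _).2.1,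
      fun _ ht => (hJ _).trans_eq (strat_pushedRuling hJ z.2 z.1 x ht).symm,
      fun _ _ ht ht' => (strat_pushedRuling hJ z.2 z.1 x ht).trans
        (strat_pushedRuling hJ z.2 z.1 x ht').symm⟩,
    continuous_stratHolink_of_uncurry <| (continuous_pushedRuling hJ).comp
      ((continuous_const.prodMk continuous_fst).prodMk continuous_snd :
        Continuous fun w : stdSimplex ℝ (Fin (m + 1)) × I => ((z, w.1), w.2))⟩,
    fun x => Subtype.ext (strat_pushedRuling hJ z.2 z.1 x I_one_ne_zero)⟩

lemma continuous_pushRulings : Continuous (pushRulings (s := s) hJ) :=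
  continuous_holink_of_uncurry (continuous_stratHolink_of_uncurry (continuous_pushedRuling hJ))

lemma pushedRuling_zero (h : Holink (stratHolinkStrat s p) (upperFlag hJ))
    (x : stdSimplex ℝ (Fin (m + 1))) (t : I) : pushedRuling hJ h 0 x t = (h.1 x).1 t := by
  rw [pushedRuling, pushTime_zero, simplexPush_one]

lemma pushedRuling_one (h : Holink (stratHolinkStrat s p) (upperFlag hJ))
    (x : stdSimplex ℝ (Fin (m + 1))) (t : I) :
    pushedRuling hJ h 1 x t = ofRulings hJ h (simplexCone t x) := by
  rw [pushedRuling, ofRulings, pushTime_one, simplexDegeneracy_simplexCone,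
    simplexHeight_simplexCone]

lemma holinkToIterated_comp_holinkOfIterated_homotopic :
    (ContinuousMap.id _).Homotopic ((holinkToIterated s hJ).comp (holinkOfIterated s hJ)) :=
  ⟨⟨⟨pushRulings hJ, continuous_pushRulings hJ⟩,
    fun h => Subtype.ext <| ContinuousMap.ext fun x => Subtype.ext <| ContinuousMap.ext fun t =>
      pushedRuling_zero hJ h x t,
    fun h => Subtype.ext <| ContinuousMap.ext fun x => Subtype.ext <| ContinuousMap.ext fun t =>
      pushedRuling_one hJ h x t⟩⟩

end Comparison

/-- **Iterated homotopy links.** For a regular flag `I = [p_1 < ⋯ < p_n]` in `P_{>p}`,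
the generalized homotopy link `Holink_I(Hol^s_p(X))` of the stratified homotopy link
(stratified over `P_{>p}`) is weakly homotopy equivalent to the generalized homotopy
link `Holink_{[p < p_1 < ⋯ < p_n]}(X)`. -/
theorem holink_of_stratHolink {P : Type} [PartialOrder P] {X : Type} [TopologicalSpace X]
    (s : X → P) (hs : AlexContinuous s) (p : P) (m : ℕ)
    (Iflag : Fin (m + 1) → P) (hI : StrictMono Iflag) (hIp : ∀ i, p < Iflag i) :
    ∃ f : C(Holink s (Fin.cons p Iflag),
            Holink (stratHolinkStrat s p) (fun i => (⟨Iflag i, hIp i⟩ : {q : P // p < q}))),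
      IsWeakHomotopyEquiv f := by
  exact ⟨holinkToIterated s hIp, isWeakHomotopyEquiv_of_homotopic_id _ (holinkOfIterated s hIp)
    (holinkOfIterated_comp_holinkToIterated_homotopic hIp)
    (holinkToIterated_comp_holinkOfIterated_homotopic hIp)⟩
end
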